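/- In the free group F₂ = F(a,b), the subgroup H = ⟨a², b³⟩ and the subgroup K = ⟨b², aba⟩ are each free of rank 2, and there is an isomorphism φ : H → K with φ(a²) = b² and φ(b³) = aba. Moreover H and K are totally geodesic with respect to the generating set {a,b} of F₂ (every geodesic word over {a,b}^{±1} representing an element of H is a concatenation of the words a^{±2}, b^{±3}, and similarly for K with b^{±2}, (aba)^{±1}), and the word lengths satisfy |a²| = |b²| = 2 and |b³| = |aba| = 3. Consequently the HNN extension G₂ = ⟨a,b,s | s⁻¹a²s = b², s⁻¹b³s = aba⟩ is an isometric (multiple) HNN extension of (F₂, {a,b}). -/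

import Mathlib

/-!  Common framework: words over an inverse-closed generating set, word length,
geodesics, falsification by fellow traveler property, almost convexity. -/

namespace ACPaper

section Core

variable {β G : Type*} [Group G]

/-- A letter is a generator (`Sum.inl`) or the formal inverse of a generator (`Sum.inr`);
this realizes the inverse-closed alphabet `X^{±1}`. -/
def letterEval (gen : β → G) : β ⊕ β → G :=
  Sum.elim gen fun b => (gen b)⁻¹

/-- Evaluation of a word over `X^{±1}` in the group. -/
def eval (gen : β → G) (w : List (β ⊕ β)) : G :=
  (w.map (letterEval gen)).prod

/-- `gen` is a generating set: every element is represented by some word. -/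
def Generates (gen : β → G) : Prop :=
  ∀ g : G, ∃ w : List (β ⊕ β), eval gen w = g

/-- Word length of a group element with respect to the generating set. -/
noncomputable def wlen (gen : β → G) (g : G) : ℕ :=
  sInf {n : ℕ | ∃ w : List (β ⊕ β), eval gen w = g ∧ w.length = n}

/-- A word is geodesic if its length equals the word length of the element it represents. -/
def IsGeodesic (gen : β → G) (w : List (β ⊕ β)) : Prop :=
  w.length = wlen gen (eval gen w)

/-- The point reached after `t` steps along the unit-speed path labelled by `w`
(the path remains at its endpoint after time `w.length`). -/
def pos (gen : β → G) (w : List (β ⊕ β)) (t : ℕ) : G :=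
  eval gen (w.take t)

/-- Synchronous falsification by fellow traveler property with constant `k`:
every non-geodesic word is synchronously `k`-fellow traveled by a shorter word
representing the same element. -/
def SynchFFTP (gen : β → G) (k : ℕ) : Prop :=
  ∀ w : List (β ⊕ β), ¬ IsGeodesic gen w →
    ∃ w' : List (β ⊕ β), eval gen w' = eval gen w ∧ w'.length < w.length ∧
      ∀ t : ℕ, wlen gen ((pos gen w t)⁻¹ * pos gen w' t) ≤ k

/-- The path starting at `g` labelled by the word `w` stays in the ball of radius `N`
about the identity. -/
def PathInBall (gen : β → G) (N : ℕ) (g : G) (w : List (β ⊕ β)) : Prop :=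
  ∀ t : ℕ, wlen gen (g * pos gen w t) ≤ N

/-- Almost convexity with constant `C`: any two elements of the sphere of radius `N ≥ 1`
at distance at most `2` are joined by a path of length at most `C` inside the ball of
radius `N`. -/
def AlmostConvexWith (gen : β → G) (C : ℕ) : Prop :=
  ∀ N : ℕ, 1 ≤ N → ∀ g g' : G, wlen gen g = N → wlen gen g' = N →
    wlen gen (g⁻¹ * g') ≤ 2 →
    ∃ w : List (β ⊕ β), g * eval gen w = g' ∧ w.length ≤ C ∧ PathInBall gen N g w

/-- Almost convexity: almost convex with some positive constant. -/
def AlmostConvex (gen : β → G) : Prop :=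
  ∃ C : ℕ, 0 < C ∧ AlmostConvexWith gen C


end Core

/-- Two letters are an inverse pair (`x` followed by `x⁻¹`, or `x⁻¹` followed by `x`). -/
def IsInvPair {β : Type*} : β ⊕ β → β ⊕ β → Prop
  | Sum.inl x, Sum.inr y => x = y
  | Sum.inr x, Sum.inl y => x = y
  | _, _ => False

/-- A word over a formal alphabet `κ^{±1}` is freely reduced. -/
def FreelyReduced {κ : Type*} (l : List (κ ⊕ κ)) : Prop :=
  l.Chain' fun a b => ¬ IsInvPair a b

/-- Every geodesic word (over `X^{±1}`) representing an element of the subgroup generated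
by `gens` is a concatenation of geodesic words, each representing an element of `gens` or
an inverse of one. -/
def TGConcat {β G : Type*} [Group G] (gen : β → G) (gens : Set G) : Prop :=
  ∀ w : List (β ⊕ β), IsGeodesic gen w → eval gen w ∈ Subgroup.closure gens →
    ∃ ps : List (List (β ⊕ β)), w = ps.flatten ∧
      ∀ p ∈ ps, IsGeodesic gen p ∧ ∃ g ∈ gens, eval gen p = g ∨ eval gen p = g⁻¹

/-- Every freely reduced word in the elements `f j` and their inverses, read as a word over
`X^{±1}` (i.e. substituting geodesic representatives), is geodesic: the word length of the
element it represents is the sum of the word lengths of its letters. -/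
def TGReducedGeodesic {β G κ : Type*} [Group G] (gen : β → G) (f : κ → G) : Prop :=
  ∀ l : List (κ ⊕ κ), FreelyReduced l →
    wlen gen (eval f l) =
      (l.map (Sum.elim (fun j => wlen gen (f j)) fun j => wlen gen (f j))).sum

/-- The subgroup generated by the family `f` is totally geodesic in `(G, gen)`. -/
def TotallyGeodesicSub {β G κ : Type*} [Group G] (gen : β → G) (f : κ → G) : Prop :=
  TGConcat gen (Set.range f) ∧ TGReducedGeodesic gen f

/-- The data of a multiple HNN extension: a finitely generated base group
`A = ⟨X ∣ R⟩` and, for each stable letter `s_i` (`i ∈ Fin n`), words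
`uw i j, vw i j` over `X` spelling the generators `u_{ij}` of `U_i` and
`v_{ij} = φ_i(u_{ij})` of `V_i`. -/
structure MHNNData where
  /-- the generating set of the base group -/
  X : Type
  /-- the generating set is finite -/
  fin : Fintype X
  /-- the relators of the base group -/
  R : Set (FreeGroup X)
  /-- the number of stable letters -/
  n : ℕ
  /-- the number of free generators of each associated subgroup -/
  m : Fin n → ℕ
  /-- words spelling the free generators of the `U_i` -/
  uw : (i : Fin n) → Fin (m i) → FreeGroup X
  /-- words spelling the free generators of the `V_i` -/
  vw : (i : Fin n) → Fin (m i) → FreeGroup X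

namespace MHNNData

variable (D : MHNNData)

/-- The base group `A = ⟨X ∣ R⟩`. -/
def A : Type := PresentedGroup D.R

instance : Group D.A := by unfold A; infer_instance

/-- The canonical projection `FreeGroup X → A`. -/
def projA : FreeGroup D.X →* D.A := PresentedGroup.mk D.R

/-- The marking of the base group by its generators. -/
def genA : D.X → D.A := fun x => PresentedGroup.of x

/-- The free generators `u_{ij}` of the associated subgroup `U_i`. -/
def u (i : Fin D.n) (j : Fin (D.m i)) : D.A := D.projA (D.uw i j)

/-- The free generators `v_{ij} = φ_i(u_{ij})` of the associated subgroup `V_i`. -/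
def v (i : Fin D.n) (j : Fin (D.m i)) : D.A := D.projA (D.vw i j)

/-- The associated subgroup `U_i`. -/
def U (i : Fin D.n) : Subgroup D.A := Subgroup.closure (Set.range (D.u i))

/-- The associated subgroup `V_i`. -/
def V (i : Fin D.n) : Subgroup D.A := Subgroup.closure (Set.range (D.v i))

/-- The relators of the multiple HNN extension
`G = ⟨X, s_1, …, s_n ∣ R, s_i⁻¹ u_{ij} s_i = v_{ij}⟩`. -/
def relsG : Set (FreeGroup (D.X ⊕ Fin D.n)) :=
  FreeGroup.map Sum.inl '' D.R ∪
    { r | ∃ (i : Fin D.n) (j : Fin (D.m i)),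
        r = (FreeGroup.of (Sum.inr i))⁻¹ * FreeGroup.map Sum.inl (D.uw i j) *
            FreeGroup.of (Sum.inr i) * (FreeGroup.map Sum.inl (D.vw i j))⁻¹ }

/-- The multiple HNN extension `G`. -/
def G : Type := PresentedGroup D.relsG

instance : Group D.G := by unfold G; infer_instance

/-- The marking of `G` by the generating set `X ∪ {s_1, …, s_n}`. -/
def genG : D.X ⊕ Fin D.n → D.G := fun x => PresentedGroup.of x

/-- Each associated subgroup `U_i`, `V_i` is free with the given (finite) free basis:
the induced maps from the free group are injective. -/
def FreeBases : Prop :=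
  ∀ i : Fin D.n,
    Function.Injective (FreeGroup.lift (D.u i) : FreeGroup (Fin (D.m i)) →* D.A) ∧
    Function.Injective (FreeGroup.lift (D.v i) : FreeGroup (Fin (D.m i)) →* D.A)

/-- All associated subgroups are totally geodesic. -/
def TotallyGeodesic : Prop :=
  ∀ i : Fin D.n,
    TotallyGeodesicSub D.genA (D.u i) ∧ TotallyGeodesicSub D.genA (D.v i)

/-- The presentation is strip equidistant: `|u_{ij}| = |v_{ij}|` in `(A,X)`. -/
def StripEquidistant : Prop :=
  ∀ (i : Fin D.n) (j : Fin (D.m i)), wlen D.genA (D.u i j) = wlen D.genA (D.v i j)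

/-- `G` is an isometric multiple HNN extension: the associated subgroups are finitely
generated free, totally geodesic, and strip equidistant. -/
def IsIsometric : Prop :=
  D.FreeBases ∧ D.TotallyGeodesic ∧ D.StripEquidistant

end MHNNData


/-- The marking of the free group `F₂ = F(a,b)` by its free basis (`0 ↦ a`, `1 ↦ b`). -/
def genF : Fin 2 → FreeGroup (Fin 2) := FreeGroup.of

/-- The free basis `{a², b³}` of the subgroup `H` of `F₂`. -/
def uF : Fin 2 → FreeGroup (Fin 2) := ![FreeGroup.of 0 ^ 2, FreeGroup.of 1 ^ 3]

/-- The free basis `{b², aba}` of the subgroup `K` of `F₂`. -/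
def vF : Fin 2 → FreeGroup (Fin 2) :=
  ![FreeGroup.of 1 ^ 2, FreeGroup.of 0 * FreeGroup.of 1 * FreeGroup.of 0]

/-- The data of the HNN extension `G₂ = ⟨a,b,s ∣ s⁻¹a²s = b², s⁻¹b³s = aba⟩` of the free
group `F₂` (presented with no relators), associating `H = ⟨a²,b³⟩` and `K = ⟨b²,aba⟩`. -/
def D₂ : MHNNData where
  X := Fin 2
  fin := inferInstance
  R := ∅
  n := 1
  m := fun _ => 2
  uw := fun _ => uF
  vw := fun _ => vF

section FreeGroupWords

open FreeGroup

variable {α κ : Type*}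

/-- The signed-letter form of a letter of `X^{±1}` used by `FreeGroup`. -/
def signedLetter : α ⊕ α ≃ α × Bool :=
  (Equiv.sumComm α α).trans ((Equiv.boolProdEquivSum α).symm.trans (Equiv.prodComm Bool α))

@[simp] lemma signedLetter_inl (x : α) : signedLetter (Sum.inl x) = (x, true) := rfl

@[simp] lemma signedLetter_inr (x : α) : signedLetter (Sum.inr x) = (x, false) := rfl

lemma eval_eq_lift {G : Type*} [Group G] (f : κ → G) (l : List (κ ⊕ κ)) :
    eval f l = lift f (FreeGroup.mk (l.map signedLetter)) := by
  rw [lift_mk, eval, List.map_map]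
  congr 2
  funext x
  cases x <;> rfl

lemma eval_of (w : List (α ⊕ α)) :
    eval (FreeGroup.of : α → FreeGroup α) w = FreeGroup.mk (w.map signedLetter) := by
  rw [eval_eq_lift, FreeGroup.lift_of_eq_id, MonoidHom.id_apply]

lemma freelyReduced_iff (l : List (κ ⊕ κ)) :
    FreelyReduced l ↔ FreeGroup.IsReduced (l.map signedLetter) := by
  unfold FreelyReduced FreeGroup.IsReduced
  rw [List.isChain_map]
  have h : (fun a b : κ ⊕ κ => ¬ IsInvPair a b) =
      fun a b => (signedLetter a).1 = (signedLetter b).1 →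
        (signedLetter a).2 = (signedLetter b).2 := by
    funext a b
    cases a <;> cases b <;> simp [IsInvPair]
  rw [h]
  rfl

variable [DecidableEq α]

lemma wlen_of (g : FreeGroup α) : wlen FreeGroup.of g = g.norm := by
  apply le_antisymm
  · refine Nat.sInf_le ⟨g.toWord.map signedLetter.symm, ?_, ?_⟩
    · simp [eval_of, mk_toWord]
    · simp [FreeGroup.norm]
  · refine le_csInf ⟨_, g.toWord.map signedLetter.symm, ?_, rfl⟩ ?_
    · simp [eval_of, mk_toWord]
    · rintro n ⟨w, rfl, rfl⟩
      rw [eval_of]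
      simpa using norm_mk_le (L₁ := w.map signedLetter)

lemma isGeodesic_of_iff (w : List (α ⊕ α)) :
    IsGeodesic FreeGroup.of w ↔ FreeGroup.IsReduced (w.map signedLetter) := by
  rw [IsGeodesic, wlen_of, eval_of, FreeGroup.norm, toWord_mk, isReduced_iff_reduce_eq]
  constructor
  · intro h
    exact ((reduce.red (L := w.map signedLetter)).sublist.eq_of_length (by simpa using h.symm))
  · intro h
    rw [h, List.length_map]

/-- The reduced word spelling the image of a signed letter under `FreeGroup.lift f`. -/
def spelling (f : κ → FreeGroup α) (x : κ × Bool) : List (α × Bool) :=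
  (lift f (FreeGroup.mk [x])).toWord

/-- The family `f` consists of nontrivial elements, and no cancellation occurs in the product of
two of them or their inverses, unless these are formally inverse to each other. -/
def NoCancellation (f : κ → FreeGroup α) : Prop :=
  (∀ x, spelling f x ≠ []) ∧
    ∀ x y : κ × Bool, (x.1 = y.1 → x.2 = y.2) → FreeGroup.IsReduced (spelling f x ++ spelling f y)

lemma mk_flatMap_spelling (f : κ → FreeGroup α) (L : List (κ × Bool)) :
    FreeGroup.mk (L.flatMap (spelling f)) = lift f (FreeGroup.mk L) := by
  induction L with
  | nil => exact (map_one (lift f)).symm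
  | cons x L ih =>
    have h : FreeGroup.mk (x :: L) = FreeGroup.mk [x] * FreeGroup.mk L := by simp
    rw [List.flatMap_cons, ← mul_mk, ih, h, MonoidHom.map_mul, spelling, mk_toWord]

namespace NoCancellation

variable {f : κ → FreeGroup α}

lemma isReduced_flatMap (hf : NoCancellation f) {L : List (κ × Bool)}
    (hL : FreeGroup.IsReduced L) :
    FreeGroup.IsReduced (L.flatMap (spelling f)) := by
  unfold FreeGroup.IsReduced
  rw [List.flatMap_def, List.isChain_flatten (fun h => by
    obtain ⟨x, -, hx⟩ := List.mem_map.1 h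
    exact hf.1 x hx)]
  constructor
  · intro l hl
    obtain ⟨x, -, rfl⟩ := List.mem_map.1 hl
    exact isReduced_toWord
  · rw [List.isChain_map]
    exact hL.imp fun x y hxy => (List.isChain_append.1 (hf.2 x y hxy)).2.2

lemma toWord_lift [DecidableEq κ] (hf : NoCancellation f) (g : FreeGroup κ) :
    (lift f g).toWord = g.toWord.flatMap (spelling f) := by
  conv_lhs => rw [← mk_toWord (x := g), ← mk_flatMap_spelling, toWord_mk]
  exact (hf.isReduced_flatMap isReduced_toWord).reduce_eq

lemma injective_lift (hf : NoCancellation f) : Function.Injective (lift f) := by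
  classical
  rw [injective_iff_map_eq_one]
  intro g hg
  have h := hf.toWord_lift g
  rw [hg, toWord_one, eq_comm, List.flatMap_eq_nil_iff] at h
  rw [← toWord_eq_nil_iff]
  exact List.eq_nil_iff_forall_not_mem.2 fun x hx => hf.1 x (h x hx)

lemma totallyGeodesicSub (hf : NoCancellation f) : TotallyGeodesicSub FreeGroup.of f := by
  classical
  constructor
  · intro w hw hmem
    rw [isGeodesic_of_iff] at hw
    rw [← range_lift_eq_closure] at hmem
    obtain ⟨g, hg⟩ := hmem
    have hword : w.map signedLetter = g.toWord.flatMap (spelling f) := by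
      rw [← hf.toWord_lift, hg, eval_of, toWord_mk, hw.reduce_eq]
    refine ⟨g.toWord.map fun x => (spelling f x).map signedLetter.symm, ?_, ?_⟩
    · have h := congrArg (List.map signedLetter.symm) hword
      simpa [List.map_flatMap, List.flatMap_def, Function.comp_def] using h
    · intro p hp
      obtain ⟨x, -, rfl⟩ := List.mem_map.1 hp
      refine ⟨?_, f x.1, ⟨x.1, rfl⟩, ?_⟩
      · rw [isGeodesic_of_iff]
        simpa [spelling] using isReduced_toWord
      · rw [eval_of, List.map_map, Equiv.self_comp_symm, List.map_id, spelling, mk_toWord]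
        rcases x with ⟨j, _ | _⟩ <;> simp
  · intro l hl
    rw [freelyReduced_iff] at hl
    rw [wlen_of, eval_eq_lift, FreeGroup.norm, hf.toWord_lift, toWord_mk, hl.reduce_eq,
      List.length_flatMap, List.map_map]
    congr 2
    funext x
    cases x <;> simp [spelling, wlen_of, FreeGroup.norm, toWord_inv, invRev_length]

end NoCancellation

end FreeGroupWords

section Transport

variable {β κ G G' : Type*} [Group G] [Group G'] (e : G ≃* G') (gen : β → G)

lemma eval_comp_mulEquiv (w : List (β ⊕ β)) : eval (e ∘ gen) w = e (eval gen w) := by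
  rw [eval, eval, map_list_prod, List.map_map]
  congr 2
  funext x
  cases x <;> simp [letterEval]

lemma wlen_comp_mulEquiv (g : G) : wlen (e ∘ gen) (e g) = wlen gen g := by
  simp only [wlen, eval_comp_mulEquiv, e.injective.eq_iff]

lemma isGeodesic_comp_mulEquiv (w : List (β ⊕ β)) :
    IsGeodesic (e ∘ gen) w ↔ IsGeodesic gen w := by
  rw [IsGeodesic, IsGeodesic, eval_comp_mulEquiv, wlen_comp_mulEquiv]

variable {gen}

lemma TotallyGeodesicSub.comp_mulEquiv {f : κ → G} (h : TotallyGeodesicSub gen f) :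
    TotallyGeodesicSub (e ∘ gen) (e ∘ f) := by
  constructor
  · intro w hw hmem
    rw [isGeodesic_comp_mulEquiv] at hw
    have hmem' : eval gen w ∈ Subgroup.closure (Set.range f) := by
      rwa [eval_comp_mulEquiv, Set.range_comp, ← MulEquiv.coe_toMonoidHom,
        ← MonoidHom.map_closure, MulEquiv.coe_toMonoidHom, ← SetLike.mem_coe,
        Subgroup.coe_map, MulEquiv.coe_toMonoidHom, e.injective.mem_set_image] at hmem
    obtain ⟨ps, hps, hp⟩ := h.1 w hw hmem'
    refine ⟨ps, hps, fun p hpm => ?_⟩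
    obtain ⟨hgeo, g, ⟨j, rfl⟩, hj⟩ := hp p hpm
    refine ⟨(isGeodesic_comp_mulEquiv e gen p).2 hgeo, e (f j), ⟨j, rfl⟩, ?_⟩
    rw [eval_comp_mulEquiv]
    exact hj.imp (congrArg e) fun h' => by rw [h', map_inv]
  · intro l hl
    simp only [eval_comp_mulEquiv, wlen_comp_mulEquiv, Function.comp_apply, h.2 l hl]

end Transport

/-- The isomorphism between the subgroups generated by two free families that matches the
families. -/
lemma exists_closure_mulEquiv {κ G : Type*} [Group G] {f f' : κ → G}
    (hf : Function.Injective (FreeGroup.lift f)) (hf' : Function.Injective (FreeGroup.lift f')) :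
    ∃ φ : Subgroup.closure (Set.range f) ≃* Subgroup.closure (Set.range f'),
      ∀ (x : Subgroup.closure (Set.range f)) (j : κ), (x : G) = f j → (φ x : G) = f' j := by
  refine ⟨(MulEquiv.subgroupCongr FreeGroup.range_lift_eq_closure.symm).trans
    ((MonoidHom.ofInjective hf).symm.trans ((MonoidHom.ofInjective hf').trans
      (MulEquiv.subgroupCongr FreeGroup.range_lift_eq_closure))), fun x j hx => ?_⟩
  have h : (MonoidHom.ofInjective hf).symm
      (MulEquiv.subgroupCongr FreeGroup.range_lift_eq_closure.symm x) = FreeGroup.of j := by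
    rw [MulEquiv.symm_apply_eq]
    apply Subtype.ext
    exact hx.trans FreeGroup.lift_apply_of.symm
  exact (congrArg (FreeGroup.lift f') h).trans FreeGroup.lift_apply_of

/-- A group presented without relators is free. -/
def presentedGroupEmptyEquiv (α : Type*) :
    FreeGroup α ≃* PresentedGroup (∅ : Set (FreeGroup α)) :=
  (QuotientGroup.quotientBot (G := FreeGroup α)).symm.trans
    (QuotientGroup.quotientMulEquivOfEq Subgroup.normalClosure_empty.symm)

lemma noCancellation_uF : NoCancellation uF := by
  unfold NoCancellation FreeGroup.IsReduced
  decide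

lemma noCancellation_vF : NoCancellation vF := by
  unfold NoCancellation FreeGroup.IsReduced
  decide

/-- In `F₂ = F(a,b)`, the subgroups `H = ⟨a²,b³⟩` and `K = ⟨b²,aba⟩`
are free of rank 2 with the indicated free bases, there is an isomorphism `φ : H → K`
with `φ(a²) = b²` and `φ(b³) = aba`, both subgroups are totally geodesic with respect to
`{a,b}`, and `|a²| = |b²| = 2`, `|b³| = |aba| = 3`. Consequently the HNN extension
`G₂ = ⟨a,b,s ∣ s⁻¹a²s = b², s⁻¹b³s = aba⟩` is an isometric (multiple) HNN extension of
`(F₂, {a,b})`. -/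
theorem hnn_of_free_group_isometric :
    Function.Injective (FreeGroup.lift uF : FreeGroup (Fin 2) →* FreeGroup (Fin 2)) ∧
    Function.Injective (FreeGroup.lift vF : FreeGroup (Fin 2) →* FreeGroup (Fin 2)) ∧
    (∃ φ : Subgroup.closure (Set.range uF) ≃* Subgroup.closure (Set.range vF),
      ∀ x : Subgroup.closure (Set.range uF),
        ((x : FreeGroup (Fin 2)) = uF 0 → (φ x : FreeGroup (Fin 2)) = vF 0) ∧
        ((x : FreeGroup (Fin 2)) = uF 1 → (φ x : FreeGroup (Fin 2)) = vF 1)) ∧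
    TotallyGeodesicSub genF uF ∧ TotallyGeodesicSub genF vF ∧
    (wlen genF (uF 0) = 2 ∧ wlen genF (vF 0) = 2 ∧
      wlen genF (uF 1) = 3 ∧ wlen genF (vF 1) = 3) ∧
    D₂.IsIsometric := by
  have hu := noCancellation_uF.injective_lift
  have hv := noCancellation_vF.injective_lift
  have hlen : wlen genF (uF 0) = 2 ∧ wlen genF (vF 0) = 2 ∧
      wlen genF (uF 1) = 3 ∧ wlen genF (vF 1) = 3 := by
    refine ⟨?_, ?_, ?_, ?_⟩ <;> rw [genF, wlen_of] <;> decide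
  have hinj {f : Fin 2 → FreeGroup (Fin 2)} (hf : Function.Injective (FreeGroup.lift f)) :
      Function.Injective (FreeGroup.lift (presentedGroupEmptyEquiv (Fin 2) ∘ f)) := by
    have h : FreeGroup.lift (presentedGroupEmptyEquiv (Fin 2) ∘ f) =
        (presentedGroupEmptyEquiv (Fin 2)).toMonoidHom.comp (FreeGroup.lift f) := by
      ext j
      simp
    rw [h]
    exact (presentedGroupEmptyEquiv (Fin 2)).injective.comp hf
  obtain ⟨φ, hφ⟩ := exists_closure_mulEquiv hu hv
  refine ⟨hu, hv, ⟨φ, fun x => ⟨hφ x 0, hφ x 1⟩⟩, noCancellation_uF.totallyGeodesicSub,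
    noCancellation_vF.totallyGeodesicSub, hlen, ?_, ?_, ?_⟩
  · intro i
    exact ⟨hinj hu, hinj hv⟩
  · intro i
    exact ⟨noCancellation_uF.totallyGeodesicSub.comp_mulEquiv (presentedGroupEmptyEquiv (Fin 2)),
      noCancellation_vF.totallyGeodesicSub.comp_mulEquiv (presentedGroupEmptyEquiv (Fin 2))⟩
  · intro i
    have hstrip (j : Fin 2) : wlen genF (uF j) = wlen genF (vF j) := by
      fin_cases j
      · exact hlen.1.trans hlen.2.1.symm
      · exact hlen.2.2.1.trans hlen.2.2.2.symm
    intro j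
    exact (wlen_comp_mulEquiv (presentedGroupEmptyEquiv (Fin 2)) genF (uF j)).trans
      ((hstrip j).trans (wlen_comp_mulEquiv (presentedGroupEmptyEquiv (Fin 2)) genF (vF j)).symm)

end ACPaper
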